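/- Let k be an algebraically closed field and let A_2 be the algebra of the quiver with vertices 1, 2, arrows α: 1 → 2, β: 2 → 1, and relation αβ = 0. Then A_2 is derived discrete: for every cohomology dimension vector (d_i)_{i∈ℤ} there are, up to isomorphism, only finitely many indecomposables X• ∈ D^b(A_2) with dim_k H^i(X•) = d_i for all i. -/

import Mathlib

open CategoryTheory TensorProduct

set_option maxHeartbeats 800000

noncomputable section

/-! ## The bounded derived category of a finite-dimensional algebra

Objects of `D^b(A)` are represented by (bounded) cochain complexes of `A`-modules;
isomorphism and indecomposability in `D^b(A)` are expressed via the localization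
functor `Q` to the derived category. -/

/-- Cochain complexes of left `A`-modules. -/
abbrev Cx (A : Type) [Ring A] := CochainComplex (ModuleCat.{0} A) ℤ

section DerCat
variable {A : Type} [Ring A]

/-- A complex is bounded. -/
def CxBounded (X : Cx A) : Prop :=
  ∃ a b : ℤ, ∀ i : ℤ, (i < a ∨ b < i) → Limits.IsZero (X.X i)

/-- Two complexes are isomorphic as objects of the derived category `D(A)`. -/
def DbIso (X Y : Cx A) : Prop :=
  letI : HasDerivedCategory (ModuleCat A) := HasDerivedCategory.standard _
  Nonempty (DerivedCategory.Q.obj X ≅ DerivedCategory.Q.obj Y)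

/-- A complex is an indecomposable object of the derived category: it is nonzero and its
endomorphism ring in the derived category has no nontrivial idempotents. -/
def DbIndec (X : Cx A) : Prop :=
  letI : HasDerivedCategory (ModuleCat A) := HasDerivedCategory.standard _
  ¬ Limits.IsZero (DerivedCategory.Q.obj X) ∧
    ∀ e : DerivedCategory.Q.obj X ⟶ DerivedCategory.Q.obj X,
      e ≫ e = e → e = 0 ∨ e = 𝟙 _

variable (k : Type) [Field k] [Algebra k A]

/-- The cohomology of `X` is finite dimensional over `k` in each degree,
with dimension vector `d`. -/
def CohDims (X : Cx A) (d : ℤ → ℕ) : Prop :=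
  ∀ i : ℤ, Module.Finite k (RestrictScalars k A (X.homology i)) ∧
    Module.finrank k (RestrictScalars k A (X.homology i)) = d i

/-- `X` represents an object of the bounded derived category of finite-dimensional
`A`-modules: it is bounded with finite-dimensional cohomology. -/
def InDb (X : Cx A) : Prop :=
  CxBounded X ∧ ∀ i : ℤ, Module.Finite k (RestrictScalars k A (X.homology i))

end DerCat

/-- Generators of the algebra `A_2`: vertices `1,2`, arrows `α : 1 → 2` (`a 0`), `β : 2 → 1` (`b 0`), with the relation `αβ = 0`. -/
inductive A2Gen where
  | e : Fin 2 → A2Gen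
  | a : Fin 1 → A2Gen
  | b : Fin 1 → A2Gen

/-- The relations presenting the algebra `A2` as a quiver algebra: the vertex idempotents
are orthogonal with sum `1`, each arrow is supported at its source and target, together with
the defining relations of the algebra. -/
inductive A2Rel (k : Type) [Field k] :
    FreeAlgebra k A2Gen → FreeAlgebra k A2Gen → Prop
  | videm (i : Fin 2) : A2Rel k (FreeAlgebra.ι k (A2Gen.e i) * FreeAlgebra.ι k (A2Gen.e i)) (FreeAlgebra.ι k (A2Gen.e i))
  | vorth (i j : Fin 2) : i ≠ j → A2Rel k (FreeAlgebra.ι k (A2Gen.e i) * FreeAlgebra.ι k (A2Gen.e j)) 0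
  | vsum : A2Rel k (∑ i : Fin 2, FreeAlgebra.ι k (A2Gen.e i)) 1
  | aloc (i : Fin 1) :
      A2Rel k (FreeAlgebra.ι k (A2Gen.e (i.castSucc)) * FreeAlgebra.ι k (A2Gen.a i) * FreeAlgebra.ι k (A2Gen.e (i.succ))) (FreeAlgebra.ι k (A2Gen.a i))
  | bloc (i : Fin 1) :
      A2Rel k (FreeAlgebra.ι k (A2Gen.e (i.succ)) * FreeAlgebra.ι k (A2Gen.b i) * FreeAlgebra.ι k (A2Gen.e (i.castSucc))) (FreeAlgebra.ι k (A2Gen.b i))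
  | r1 : A2Rel k ((FreeAlgebra.ι k (A2Gen.a 0)) * (FreeAlgebra.ι k (A2Gen.b 0))) 0

/-- The quiver algebra `A2`. -/
abbrev A2Alg (k : Type) [Field k] : Type := RingQuot (A2Rel k)

/-- A finite-dimensional `k`-algebra is *derived discrete* if for every cohomology dimension
vector there are, up to isomorphism, only finitely many indecomposables in `D^b(A)` with that
cohomology dimension vector. -/
def DerivedDiscrete (k A : Type) [Field k] [Ring A] [Algebra k A] : Prop :=
  ∀ d : ℤ → ℕ, ∃ (n : ℕ) (Y : Fin n → Cx A),
    ∀ X : Cx A, CxBounded X → CohDims k X d → DbIndec X → ∃ j : Fin n, DbIso X (Y j)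

section Criterion
variable {A : Type} [Ring A]

/-- Elementwise criterion for a morphism of complexes of modules to be a quasi-isomorphism. -/
lemma Cx.quasiIso_of_elements {K L : Cx A} (f : K ⟶ L)
    (hinj : ∀ (i : ℤ) (z : K.X (i + 1)) (y : L.X i), K.d (i + 1) (i + 1 + 1) z = 0 →
      f.f (i + 1) z = L.d i (i + 1) y → ∃ w, z = K.d i (i + 1) w)
    (hsurj : ∀ (i : ℤ) (z : L.X (i + 1)), L.d (i + 1) (i + 1 + 1) z = 0 →
      ∃ (x : K.X (i + 1)) (w : L.X i), K.d (i + 1) (i + 1 + 1) x = 0 ∧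
        z = f.f (i + 1) x + L.d i (i + 1) w) : QuasiIso f := by
  constructor
  intro j
  obtain ⟨i, rfl⟩ : ∃ i, j = i + 1 := ⟨j - 1, by omega⟩
  rw [quasiIsoAt_iff' f i (i + 1) (i + 1 + 1) (by simp) (by simp)]
  set φ := (HomologicalComplex.shortComplexFunctor' (ModuleCat A) (ComplexShape.up ℤ)
    i (i + 1) (i + 1 + 1)).map f
  let h₁ := (K.sc' i (i + 1) (i + 1 + 1)).moduleCatLeftHomologyData
  let h₂ := (L.sc' i (i + 1) (i + 1 + 1)).moduleCatLeftHomologyData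
  let γ : ShortComplex.LeftHomologyMapData φ h₁ h₂ := default
  rw [γ.quasiIso_iff]
  have hi : ∀ x : h₁.K, h₂.i (γ.φK x) = f.f (i + 1) (h₁.i x) := fun x ↦
    congr($(γ.commi) x)
  have hπ : ∀ x : h₁.K, γ.φH (h₁.π x) = h₂.π (γ.φK x) := fun x ↦ congr($(γ.commπ) x)
  have s₁ : Function.Surjective h₁.π := Submodule.mkQ_surjective _
  have s₂ : Function.Surjective h₂.π := Submodule.mkQ_surjective _
  have e₁ : ∀ x : h₁.K, (h₁.π x = 0 ↔ ∃ w, h₁.i x = K.d i (i + 1) w) := by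
    intro x
    refine (Submodule.Quotient.mk_eq_zero _).trans ⟨?_, ?_⟩
    · rintro ⟨w, rfl⟩
      exact ⟨w, rfl⟩
    · rintro ⟨w, hw⟩
      exact ⟨w, Subtype.ext hw.symm⟩
  have e₂ : ∀ x : h₂.K, (h₂.π x = 0 ↔ ∃ w, h₂.i x = L.d i (i + 1) w) := by
    intro x
    refine (Submodule.Quotient.mk_eq_zero _).trans ⟨?_, ?_⟩
    · rintro ⟨w, rfl⟩
      exact ⟨w, rfl⟩
    · rintro ⟨w, hw⟩
      exact ⟨w, Subtype.ext hw.symm⟩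
  have : Mono γ.φH := by
    rw [ModuleCat.mono_iff_injective, injective_iff_map_eq_zero]
    intro a ha
    obtain ⟨x, rfl⟩ := s₁ a
    rw [hπ, e₂] at ha
    obtain ⟨w, hw⟩ := ha
    rw [hi] at hw
    rw [e₁]
    exact hinj i _ w x.2 hw
  have : Epi γ.φH := by
    rw [ModuleCat.epi_iff_surjective]
    intro a
    obtain ⟨z, rfl⟩ := s₂ a
    obtain ⟨x, w, hx, hw⟩ := hsurj i (h₂.i z) z.2
    obtain ⟨x, rfl⟩ : ∃ x' : h₁.K, h₁.i x' = x := ⟨⟨x, hx⟩, rfl⟩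
    refine ⟨h₁.π x, ?_⟩
    rw [hπ, eq_comm, ← sub_eq_zero, ← map_sub, e₂]
    refine ⟨w, ?_⟩
    rw [map_sub, hi, hw]
    exact add_sub_cancel_left _ _
  exact isIso_of_mono_of_epi _

lemma Cx.exists_of_isZero_homology {K : Cx A} (i : ℤ)
    (h : Limits.IsZero (K.homology (i + 1))) (z : K.X (i + 1))
    (hz : K.d (i + 1) (i + 1 + 1) z = 0) : ∃ w, K.d i (i + 1) w = z := by
  have := (K.exactAt_iff_isZero_homology (i + 1)).2 h
  rw [K.exactAt_iff' i (i + 1) (i + 1 + 1) (by simp) (by simp),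
    ShortComplex.moduleCat_exact_iff] at this
  exact this z hz

lemma DbIso.of_quasiIso {X Y : Cx A} (f : X ⟶ Y) [QuasiIso f] : DbIso X Y := by
  let _ : HasDerivedCategory (ModuleCat A) := HasDerivedCategory.standard _
  exact ⟨asIso (DerivedCategory.Q.map f)⟩

lemma DbIso.symm {X Y : Cx A} (h : DbIso X Y) : DbIso Y X := by
  obtain ⟨e⟩ := h
  exact ⟨e.symm⟩

lemma DbIso.trans {X Y Z : Cx A} (h : DbIso X Y) (h' : DbIso Y Z) : DbIso X Z := by
  obtain ⟨e⟩ := h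
  obtain ⟨e'⟩ := h'
  exact ⟨e ≪≫ e'⟩

/-- In the derived category, an indecomposable object is isomorphic to each of its
nonzero retracts. -/
lemma DbIndec.dbIso_of_retract {X Y I : Cx A} (hX : DbIndec X) (e : DbIso X Y)
    (r : Retract I Y) (hI : ¬ QuasiIso (0 : I ⟶ I)) : DbIso X I := by
  let _ : HasDerivedCategory (ModuleCat A) := HasDerivedCategory.standard _
  obtain ⟨e⟩ := e
  have hr : DerivedCategory.Q.map r.i ≫ DerivedCategory.Q.map r.r = 𝟙 _ := by
    rw [← Functor.map_comp, r.retract, CategoryTheory.Functor.map_id]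
  have h := hX.2 (e.hom ≫ DerivedCategory.Q.map r.r ≫ DerivedCategory.Q.map r.i ≫ e.inv)
    (by simp [reassoc_of% hr])
  rcases h with h | h
  · exfalso
    have h0 : 𝟙 (DerivedCategory.Q.obj I) = 0 := by
      have := DerivedCategory.Q.map r.i ≫= (e.inv ≫= h =≫ e.hom) =≫ DerivedCategory.Q.map r.r
      simpa [hr, reassoc_of% hr] using this
    apply hI
    rw [← DerivedCategory.isIso_Q_map_iff_quasiIso]
    have hz : Limits.IsZero (DerivedCategory.Q.obj I) := (Limits.IsZero.iff_id_eq_zero _).2 h0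
    exact ⟨0, hz.eq_of_src _ _, hz.eq_of_src _ _⟩
  · refine ⟨⟨e.hom ≫ DerivedCategory.Q.map r.r, DerivedCategory.Q.map r.i ≫ e.inv, ?_, ?_⟩⟩
    · simpa using h
    · simpa using hr

lemma DbIndec.not_isZero {X Y : Cx A} (hX : DbIndec X) (e : DbIso X Y) :
    ¬ ∀ i, Subsingleton (Y.X i) := by
  let _ : HasDerivedCategory (ModuleCat A) := HasDerivedCategory.standard _
  obtain ⟨e⟩ := e
  intro h
  refine hX.1 (Limits.IsZero.of_iso (DerivedCategory.Q.map_isZero ?_) e)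
  rw [Limits.IsZero.iff_id_eq_zero]
  ext i v
  exact Subsingleton.elim (α := Y.X i) _ _

lemma Cx.exists_of_quasiIso_zero {K : Cx A} (h : QuasiIso (0 : K ⟶ K)) (i : ℤ)
    (z : K.X (i + 1)) (hz : K.d (i + 1) (i + 1 + 1) z = 0) : ∃ w, K.d i (i + 1) w = z := by
  refine Cx.exists_of_isZero_homology i ?_ z hz
  have : IsIso (HomologicalComplex.homologyMap (0 : K ⟶ K) (i + 1)) := inferInstance
  rw [HomologicalComplex.homologyMap_zero] at this
  rw [Limits.IsZero.iff_id_eq_zero, ← IsIso.hom_inv_id (0 : K.homology (i + 1) ⟶ K.homology (i + 1)),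
    Limits.zero_comp]

end Criterion

section Modules
variable {k : Type} [Field k]

namespace A2Alg

/-- The image of a generator in `A2Alg k`. -/
def gen (k : Type) [Field k] (g : A2Gen) : A2Alg k :=
  RingQuot.mkAlgHom k (A2Rel k) (FreeAlgebra.ι k g)

lemma rel_eq {s t : FreeAlgebra k A2Gen} (h : A2Rel k s t) :
    RingQuot.mkAlgHom k (A2Rel k) s = RingQuot.mkAlgHom k (A2Rel k) t :=
  RingQuot.mkAlgHom_rel k h

lemma e_mul_e (i : Fin 2) : gen k (.e i) * gen k (.e i) = gen k (.e i) := by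
  simpa [gen] using rel_eq (A2Rel.videm (k := k) i)

lemma e_mul_e_of_ne {i j : Fin 2} (h : i ≠ j) : gen k (.e i) * gen k (.e j) = 0 := by
  simpa [gen] using rel_eq (A2Rel.vorth (k := k) i j h)

lemma e_add_e : gen k (.e 0) + gen k (.e 1) = 1 := by
  simpa [gen] using rel_eq (A2Rel.vsum (k := k))

lemma e_mul_a_mul_e : gen k (.e 0) * gen k (.a 0) * gen k (.e 1) = gen k (.a 0) := by
  simpa [gen] using rel_eq (A2Rel.aloc (k := k) 0)

lemma e_mul_b_mul_e : gen k (.e 1) * gen k (.b 0) * gen k (.e 0) = gen k (.b 0) := by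
  simpa [gen] using rel_eq (A2Rel.bloc (k := k) 0)

lemma a_mul_b : gen k (.a 0) * gen k (.b 0) = 0 := by
  simpa [gen] using rel_eq (A2Rel.r1 (k := k))

/-- An additive map commuting with scalars and generators is linear over `A2Alg k`. -/
def linearMapOfGen {M N : Type} [AddCommGroup M] [AddCommGroup N] [Module (A2Alg k) M]
    [Module (A2Alg k) N] (f : M →+ N)
    (hk : ∀ (c : k) m, f (algebraMap k (A2Alg k) c • m) = algebraMap k (A2Alg k) c • f m)
    (hg : ∀ g m, f (gen k g • m) = gen k g • f m) : M →ₗ[A2Alg k] N where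
  __ := f
  map_smul' r m := by
    change f (r • m) = r • f m
    obtain ⟨r, rfl⟩ := RingQuot.mkAlgHom_surjective k (A2Rel k) r
    induction r generalizing m with
    | grade0 c => simpa using hk c m
    | grade1 g => exact hg g m
    | mul a b ha hb => rw [map_mul, mul_smul, ha, hb, mul_smul]
    | add a b ha hb => rw [map_add, add_smul, map_add, ha, hb, add_smul]

end A2Alg

/-- The module over `A2Alg k` attached to a representation `x : W → U`, `y : U → W`. -/
def QRep {U W : Type} [AddCommGroup U] [AddCommGroup W] [Module k U] [Module k W]
    (x : W →ₗ[k] U) (y : U →ₗ[k] W) (_ : ∀ u, x (y u) = 0) : Type := U × W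

namespace QRep
variable {U W : Type} [AddCommGroup U] [AddCommGroup W] [Module k U] [Module k W]
  {x : W →ₗ[k] U} {y : U →ₗ[k] W} {h : ∀ u, x (y u) = 0}

instance : AddCommGroup (QRep x y h) := inferInstanceAs (AddCommGroup (U × W))

/-- The two components of an element of a representation. -/
def toProd : QRep x y h ≃+ U × W := AddEquiv.refl _

/-- The operators by which the generators act on a representation. -/
def genAct (x : W →ₗ[k] U) (y : U →ₗ[k] W) : A2Gen → Module.End k (U × W)
  | .e 0 => LinearMap.inl k U W ∘ₗ LinearMap.fst k U W
  | .e 1 => LinearMap.inr k U W ∘ₗ LinearMap.snd k U W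
  | .a _ => LinearMap.inl k U W ∘ₗ x ∘ₗ LinearMap.snd k U W
  | .b _ => LinearMap.inr k U W ∘ₗ y ∘ₗ LinearMap.fst k U W

lemma genAct_rel (hxy : ∀ u, x (y u) = 0) {s t : FreeAlgebra k A2Gen} (r : A2Rel k s t) :
    FreeAlgebra.lift k (genAct x y) s = FreeAlgebra.lift k (genAct x y) t := by
  cases r with
  | videm i => fin_cases i <;> ext <;> simp [genAct]
  | vorth i j hij =>
    fin_cases i <;> fin_cases j <;> first | exact absurd rfl hij | ext <;> simp [genAct]
  | vsum => ext <;> simp [genAct]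
  | aloc i => fin_cases i; ext <;> simp [genAct]
  | bloc i => fin_cases i; ext <;> simp [genAct]
  | r1 => ext <;> simp [genAct, hxy]

/-- The action of `A2Alg k` on a representation. -/
def act (hxy : ∀ u, x (y u) = 0) : A2Alg k →ₐ[k] Module.End k (U × W) :=
  RingQuot.liftAlgHom k ⟨FreeAlgebra.lift k (genAct x y), fun _ _ r ↦ genAct_rel hxy r⟩

instance : Module (A2Alg k) (QRep x y h) :=
  Module.compHom (U × W) (act h).toRingHom

lemma toProd_algebraMap_smul (c : k) (p : QRep x y h) :
    toProd (algebraMap k (A2Alg k) c • p) = c • toProd p := by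
  change act h (algebraMap k (A2Alg k) c) (toProd p) = _
  simp

lemma toProd_gen_smul (g : A2Gen) (p : QRep x y h) :
    toProd (A2Alg.gen k g • p) = genAct x y g (toProd p) := by
  change act h (A2Alg.gen k g) (toProd p) = _
  simp [act, A2Alg.gen]

end QRep

/-- A complex of vector spaces, with differentials indexed by their source. -/
structure VecCx (k : Type) [Field k] where
  V : ℤ → Type
  [grp : ∀ i, AddCommGroup (V i)]
  [mod : ∀ i, Module k (V i)]
  d : ∀ i, V i →ₗ[k] V (i + 1)
  dd : ∀ i v, d (i + 1) (d i v) = 0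

attribute [instance] VecCx.grp VecCx.mod
attribute [simp] VecCx.dd

/-- A complex of vector spaces is exact in degree `i + 1`. -/
def VecCx.ExactSucc (C : VecCx k) (i : ℤ) : Prop :=
  ∀ z : C.V (i + 1), C.d (i + 1) z = 0 → ∃ w, C.d i w = z

/-- A complex of representations of the quiver of `A_2`, satisfying the relation. -/
structure RepCx (k : Type) [Field k] where
  U : VecCx k
  W : VecCx k
  x : ∀ i, W.V i →ₗ[k] U.V i
  y : ∀ i, U.V i →ₗ[k] W.V i
  xd : ∀ i w, x (i + 1) (W.d i w) = U.d i (x i w)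
  yd : ∀ i u, y (i + 1) (U.d i u) = W.d i (y i u)
  xy : ∀ i u, x i (y i u) = 0

attribute [simp] RepCx.xd RepCx.yd RepCx.xy

namespace RepCx

/-- A morphism of complexes of representations. -/
structure Hom (R S : RepCx k) where
  fU : ∀ i, R.U.V i →ₗ[k] S.U.V i
  fW : ∀ i, R.W.V i →ₗ[k] S.W.V i
  dU : ∀ i u, fU (i + 1) (R.U.d i u) = S.U.d i (fU i u)
  dW : ∀ i w, fW (i + 1) (R.W.d i w) = S.W.d i (fW i w)
  x : ∀ i w, fU i (R.x i w) = S.x i (fW i w)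
  y : ∀ i u, fW i (R.y i u) = S.y i (fU i u)

/-- The term in degree `i` of a complex of representations. -/
abbrev Obj (R : RepCx k) (i : ℤ) : Type := QRep (R.x i) (R.y i) (R.xy i)

/-- Linear maps between representations from pairs of maps compatible with the structure. -/
def objMap {U W U' W' : Type} [AddCommGroup U] [AddCommGroup W] [Module k U] [Module k W]
    [AddCommGroup U'] [AddCommGroup W'] [Module k U'] [Module k W']
    {x : W →ₗ[k] U} {y : U →ₗ[k] W} {h : ∀ u, x (y u) = 0}
    {x' : W' →ₗ[k] U'} {y' : U' →ₗ[k] W'} {h' : ∀ u, x' (y' u) = 0}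
    (f : U →ₗ[k] U') (g : W →ₗ[k] W') (hx : ∀ w, f (x w) = x' (g w))
    (hy : ∀ u, g (y u) = y' (f u)) : QRep x y h →ₗ[A2Alg k] QRep x' y' h' :=
  A2Alg.linearMapOfGen (QRep.toProd.symm.toAddMonoidHom.comp
      ((f.prodMap g).toAddMonoidHom.comp QRep.toProd.toAddMonoidHom))
    (fun c m ↦ QRep.toProd.injective
      (by simp [QRep.toProd_algebraMap_smul]))
    (fun a m ↦ QRep.toProd.injective (by
      rcases a with i | i | i
      · fin_cases i <;> simp [QRep.toProd_gen_smul, QRep.genAct]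
      · simp [QRep.toProd_gen_smul, QRep.genAct, hx]
      · simp [QRep.toProd_gen_smul, QRep.genAct, hy]))

/-- The complex of modules attached to a complex of representations. -/
def toCx (R : RepCx k) : Cx (A2Alg k) :=
  CochainComplex.of (fun i ↦ ModuleCat.of (A2Alg k) (R.Obj i))
    (fun i ↦ ModuleCat.ofHom (objMap (R.U.d i) (R.W.d i) (fun w ↦ (R.xd i w).symm)
      (fun u ↦ (R.yd i u).symm)))
    (fun i ↦ by
      ext p
      exact Prod.ext (R.U.dd i p.1) (R.W.dd i p.2))

/-- An element of `R.toCx` from its two components. -/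
def mkEl (R : RepCx k) {i : ℤ} (u : R.U.V i) (w : R.W.V i) : R.toCx.X i :=
  (QRep.toProd.symm (u, w) : R.Obj i)

lemma exists_mkEl (R : RepCx k) {i : ℤ} (p : R.toCx.X i) : ∃ u w, p = R.mkEl u w :=
  ⟨p.1, p.2, rfl⟩

lemma mkEl_inj (R : RepCx k) {i : ℤ} {u u' : R.U.V i} {w w' : R.W.V i} :
    R.mkEl u w = R.mkEl u' w' ↔ u = u' ∧ w = w' := Prod.mk_inj

lemma zero_eq_mkEl (R : RepCx k) (i : ℤ) : (0 : R.toCx.X i) = R.mkEl 0 0 := rfl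

lemma mkEl_add (R : RepCx k) {i : ℤ} (u u' : R.U.V i) (w w' : R.W.V i) :
    R.mkEl u w + R.mkEl u' w' = R.mkEl (u + u') (w + w') := rfl

lemma toCx_d (R : RepCx k) (i : ℤ) (u : R.U.V i) (w : R.W.V i) :
    R.toCx.d i (i + 1) (R.mkEl u w) = R.mkEl (R.U.d i u) (R.W.d i w) := by
  dsimp only [toCx]
  rw [CochainComplex.of_d]
  rfl

/-- The map of complexes of modules attached to a morphism of complexes of representations. -/
def Hom.toCx {R S : RepCx k} (f : Hom R S) : R.toCx ⟶ S.toCx where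
  f i := ModuleCat.ofHom (objMap (f.fU i) (f.fW i) (f.x i) (f.y i))
  comm' i j hij := by
    obtain rfl : i + 1 = j := hij
    ext p
    obtain ⟨u, w, rfl⟩ := R.exists_mkEl p
    change S.toCx.d i (i + 1) (S.mkEl (f.fU i u) (f.fW i w)) = _
    rw [toCx_d]
    change _ = ModuleCat.ofHom (objMap (f.fU _) (f.fW _) (f.x _) (f.y _))
      (R.toCx.d i (i + 1) (R.mkEl u w))
    rw [toCx_d, ← f.dU, ← f.dW]
    rfl

lemma Hom.toCx_f {R S : RepCx k} (f : Hom R S) (i : ℤ) (u : R.U.V i) (w : R.W.V i) :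
    f.toCx.f i (R.mkEl u w) = S.mkEl (f.fU i u) (f.fW i w) := rfl

/-- A morphism of complexes of representations that is a quasi-isomorphism on both
components induces a quasi-isomorphism of complexes of modules. -/
lemma Hom.quasiIso_toCx {R S : RepCx k} (f : Hom R S)
    (iU : ∀ i (z : R.U.V (i + 1)) (u : S.U.V i), R.U.d (i + 1) z = 0 →
      f.fU (i + 1) z = S.U.d i u → ∃ v, z = R.U.d i v)
    (iW : ∀ i (z : R.W.V (i + 1)) (u : S.W.V i), R.W.d (i + 1) z = 0 →
      f.fW (i + 1) z = S.W.d i u → ∃ v, z = R.W.d i v)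
    (sU : ∀ i (z : S.U.V (i + 1)), S.U.d (i + 1) z = 0 →
      ∃ v u, R.U.d (i + 1) v = 0 ∧ z = f.fU (i + 1) v + S.U.d i u)
    (sW : ∀ i (z : S.W.V (i + 1)), S.W.d (i + 1) z = 0 →
      ∃ v u, R.W.d (i + 1) v = 0 ∧ z = f.fW (i + 1) v + S.W.d i u) :
    QuasiIso f.toCx := by
  apply Cx.quasiIso_of_elements
  · intro i z y hz hy
    obtain ⟨u, w, rfl⟩ := R.exists_mkEl z
    obtain ⟨u', w', rfl⟩ := S.exists_mkEl y
    rw [toCx_d, zero_eq_mkEl, mkEl_inj] at hz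
    rw [toCx_d, toCx_f, mkEl_inj] at hy
    obtain ⟨v, rfl⟩ := iU i u u' hz.1 hy.1
    obtain ⟨v', rfl⟩ := iW i w w' hz.2 hy.2
    exact ⟨R.mkEl v v', (toCx_d ..).symm⟩
  · intro i z hz
    obtain ⟨u, w, rfl⟩ := S.exists_mkEl z
    rw [toCx_d, zero_eq_mkEl, mkEl_inj] at hz
    obtain ⟨v, t, hv, rfl⟩ := sU i u hz.1
    obtain ⟨v', t', hv', rfl⟩ := sW i w hz.2
    refine ⟨R.mkEl v v', S.mkEl t t', ?_, ?_⟩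
    · rw [toCx_d, hv, hv', zero_eq_mkEl]
    · rw [toCx_d, toCx_f, mkEl_add]

end RepCx

/-- The part of a module over `A2Alg k` fixed by `e`. -/
def ePart (k : Type) [Field k] (e : Fin 2) (M : Type) [AddCommGroup M] [Module (A2Alg k) M] :
    AddSubgroup M where
  carrier := {m | A2Alg.gen k (.e e) • m = m}
  zero_mem' := smul_zero _
  add_mem' ha hb := by simp_all
  neg_mem' ha := by simp_all

namespace ePart
variable {M N : Type} [AddCommGroup M] [Module (A2Alg k) M] [AddCommGroup N] [Module (A2Alg k) N]

lemma gen_smul {e : Fin 2} (m : ePart k e M) : A2Alg.gen k (.e e) • (m : M) = m := m.2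

lemma gen_smul_mem (e : Fin 2) (m : M) : A2Alg.gen k (.e e) • m ∈ ePart k e M := by
  change _ • _ • _ = _
  rw [← mul_smul, A2Alg.e_mul_e]

lemma gen_smul_of_ne {e e' : Fin 2} (h : e ≠ e') (m : ePart k e' M) :
    A2Alg.gen k (.e e) • (m : M) = 0 := by
  rw [← gen_smul m, ← mul_smul, A2Alg.e_mul_e_of_ne h, zero_smul]

instance (e : Fin 2) : Module k (ePart k e M) where
  smul c m := ⟨algebraMap k (A2Alg k) c • (m : M), by
    change _ • _ • _ = _
    rw [← mul_smul, ← Algebra.commutes, mul_smul, gen_smul]⟩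
  one_smul m := Subtype.ext (by
    change algebraMap k (A2Alg k) 1 • (m : M) = m
    simp)
  mul_smul a b m := Subtype.ext (by
    change algebraMap k (A2Alg k) (a * b) • (m : M) =
      algebraMap k (A2Alg k) a • algebraMap k (A2Alg k) b • (m : M)
    rw [map_mul, mul_smul])
  smul_zero a := Subtype.ext (smul_zero _)
  smul_add a m n := Subtype.ext (smul_add _ _ _)
  add_smul a b m := Subtype.ext (by
    change algebraMap k (A2Alg k) (a + b) • (m : M) =
      algebraMap k (A2Alg k) a • (m : M) + algebraMap k (A2Alg k) b • (m : M)
    rw [map_add, add_smul])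
  zero_smul m := Subtype.ext (by
    change algebraMap k (A2Alg k) 0 • (m : M) = 0
    simp)

/-- The `k`-linear map between parts induced by an `A2Alg k`-linear map. -/
def map (e : Fin 2) (f : M →ₗ[A2Alg k] N) : ePart k e M →ₗ[k] ePart k e N where
  toFun m := ⟨f m, by
    change _ • _ = _
    rw [← map_smul, gen_smul]⟩
  map_add' m n := Subtype.ext (map_add f _ _)
  map_smul' c m := Subtype.ext (map_smul f _ _)

/-- The `k`-linear map between parts given by multiplication by an element. -/
def mulMap (e e' : Fin 2) (r : A2Alg k) (hr : A2Alg.gen k (.e e') * r = r) :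
    ePart k e M →ₗ[k] ePart k e' M where
  toFun m := ⟨r • (m : M), by
    change _ • _ • _ = _
    rw [← mul_smul, hr]⟩
  map_add' m n := Subtype.ext (smul_add r _ _)
  map_smul' c m := Subtype.ext (by
    change r • algebraMap k (A2Alg k) c • (m : M) = algebraMap k (A2Alg k) c • r • (m : M)
    rw [← mul_smul, ← Algebra.commutes, mul_smul])

end ePart

namespace RepCx

lemma e_mul_a : A2Alg.gen k (.e 0) * A2Alg.gen k (.a 0) = A2Alg.gen k (.a 0) := by
  rw [← A2Alg.e_mul_a_mul_e, ← mul_assoc, ← mul_assoc, A2Alg.e_mul_e]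

lemma e_mul_b : A2Alg.gen k (.e 1) * A2Alg.gen k (.b 0) = A2Alg.gen k (.b 0) := by
  rw [← A2Alg.e_mul_b_mul_e, ← mul_assoc, ← mul_assoc, A2Alg.e_mul_e]

lemma a_smul {M : Type} [AddCommGroup M] [Module (A2Alg k) M] (m : M) :
    A2Alg.gen k (.a 0) • A2Alg.gen k (.e 1) • m = A2Alg.gen k (.a 0) • m := by
  rw [← mul_smul, ← A2Alg.e_mul_a_mul_e, mul_assoc _ _ (A2Alg.gen k (.e 1)), A2Alg.e_mul_e]

lemma b_smul {M : Type} [AddCommGroup M] [Module (A2Alg k) M] (m : M) :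
    A2Alg.gen k (.b 0) • A2Alg.gen k (.e 0) • m = A2Alg.gen k (.b 0) • m := by
  rw [← mul_smul, ← A2Alg.e_mul_b_mul_e, mul_assoc _ _ (A2Alg.gen k (.e 0)), A2Alg.e_mul_e]

lemma Cx.d_d (X : Cx (A2Alg k)) (i : ℤ) (m : X.X i) :
    X.d (i + 1) (i + 1 + 1) (X.d i (i + 1) m) = 0 :=
  congr($(X.d_comp_d i (i + 1) (i + 1 + 1)) m)

/-- The complex of `e`-parts of a complex of modules. -/
def partCx (X : Cx (A2Alg k)) (e : Fin 2) : VecCx k where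
  V i := ePart k e (X.X i)
  d i := ePart.map e (X.d i (i + 1)).hom
  dd i v := Subtype.ext (Cx.d_d X i v)

/-- The complex of representations attached to a complex of modules. -/
def ofCx (X : Cx (A2Alg k)) : RepCx k where
  U := partCx X 0
  W := partCx X 1
  x i := ePart.mulMap 1 0 (A2Alg.gen k (.a 0)) e_mul_a
  y i := ePart.mulMap 0 1 (A2Alg.gen k (.b 0)) e_mul_b
  xd i w := Subtype.ext (map_smul (X.d i (i + 1)).hom _ _).symm
  yd i w := Subtype.ext (map_smul (X.d i (i + 1)).hom _ _).symm
  xy i u := Subtype.ext (by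
    change A2Alg.gen k (.a 0) • A2Alg.gen k (.b 0) • (show ePart k 0 (X.X i) from u).1 = 0
    rw [← mul_smul, A2Alg.a_mul_b, zero_smul])

/-- The decomposition of an element into its two parts. -/
def ofCxMap (X : Cx (A2Alg k)) (i : ℤ) : X.X i →ₗ[A2Alg k] (ofCx X).Obj i :=
  A2Alg.linearMapOfGen
    { toFun := fun m ↦ (QRep.toProd.symm ((⟨_, ePart.gen_smul_mem 0 m⟩ : ePart k 0 (X.X i)),
        (⟨_, ePart.gen_smul_mem 1 m⟩ : ePart k 1 (X.X i))) : (ofCx X).Obj i)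
      map_zero' := Prod.ext (Subtype.ext (smul_zero _)) (Subtype.ext (smul_zero _))
      map_add' := fun m n ↦ Prod.ext (Subtype.ext (smul_add _ _ _))
        (Subtype.ext (smul_add _ _ _)) }
    (fun c m ↦ QRep.toProd.injective (by
      rw [QRep.toProd_algebraMap_smul]
      refine Prod.ext (Subtype.ext ?_) (Subtype.ext ?_) <;>
      · change _ • _ • m = algebraMap k (A2Alg k) c • _ • m
        rw [← mul_smul, ← mul_smul, Algebra.commutes]))
    (fun a m ↦ QRep.toProd.injective (by
      rw [QRep.toProd_gen_smul]
      rcases a with e | e | e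
      · fin_cases e
        · refine Prod.ext (Subtype.ext ?_) (Subtype.ext ?_)
          · change A2Alg.gen k (.e 0) • A2Alg.gen k (.e 0) • m = A2Alg.gen k (.e 0) • m
            rw [← mul_smul, A2Alg.e_mul_e]
          · change A2Alg.gen k (.e 1) • A2Alg.gen k (.e 0) • m = 0
            rw [← mul_smul, A2Alg.e_mul_e_of_ne (by decide), zero_smul]
        · refine Prod.ext (Subtype.ext ?_) (Subtype.ext ?_)
          · change A2Alg.gen k (.e 0) • A2Alg.gen k (.e 1) • m = 0
            rw [← mul_smul, A2Alg.e_mul_e_of_ne (by decide), zero_smul]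
          · change A2Alg.gen k (.e 1) • A2Alg.gen k (.e 1) • m = A2Alg.gen k (.e 1) • m
            rw [← mul_smul, A2Alg.e_mul_e]
      · obtain rfl : e = 0 := Subsingleton.elim _ _
        refine Prod.ext (Subtype.ext ?_) (Subtype.ext ?_)
        · change A2Alg.gen k (.e 0) • A2Alg.gen k (.a 0) • m =
            A2Alg.gen k (.a 0) • A2Alg.gen k (.e 1) • m
          rw [a_smul, ← mul_smul, e_mul_a]
        · change A2Alg.gen k (.e 1) • A2Alg.gen k (.a 0) • m = 0
          rw [← e_mul_a, ← mul_smul, ← mul_assoc, A2Alg.e_mul_e_of_ne (by decide), zero_mul,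
            zero_smul]
      · obtain rfl : e = 0 := Subsingleton.elim _ _
        refine Prod.ext (Subtype.ext ?_) (Subtype.ext ?_)
        · change A2Alg.gen k (.e 0) • A2Alg.gen k (.b 0) • m = 0
          rw [← e_mul_b, ← mul_smul, ← mul_assoc, A2Alg.e_mul_e_of_ne (by decide), zero_mul,
            zero_smul]
        · change A2Alg.gen k (.e 1) • A2Alg.gen k (.b 0) • m =
            A2Alg.gen k (.b 0) • A2Alg.gen k (.e 0) • m
          rw [b_smul, ← mul_smul, e_mul_b]))

/-- The comparison map from a complex to the one built from its two parts. -/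
def ofCxHom (X : Cx (A2Alg k)) : X ⟶ (ofCx X).toCx where
  f i := ModuleCat.ofHom (ofCxMap X i)
  comm' i j hij := by
    obtain rfl : i + 1 = j := hij
    ext m
    refine ((ofCx X).toCx_d i ⟨_, ePart.gen_smul_mem 0 m⟩ ⟨_, ePart.gen_smul_mem 1 m⟩).trans ?_
    exact Prod.ext (Subtype.ext (map_smul (X.d i (i + 1)).hom _ m))
      (Subtype.ext (map_smul (X.d i (i + 1)).hom _ m))

lemma ofCxHom_f (X : Cx (A2Alg k)) (i : ℤ) (m : X.X i) :
    (ofCxHom X).f i m = (ofCx X).mkEl (⟨_, ePart.gen_smul_mem 0 m⟩ : ePart k 0 (X.X i))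
      (⟨_, ePart.gen_smul_mem 1 m⟩ : ePart k 1 (X.X i)) := rfl

instance (X : Cx (A2Alg k)) : QuasiIso (ofCxHom X) := by
  have hsum : ∀ (i : ℤ) (m : X.X i),
      m = A2Alg.gen k (.e 0) • m + A2Alg.gen k (.e 1) • m := fun i m ↦ by
    rw [← add_smul, A2Alg.e_add_e, one_smul]
  apply Cx.quasiIso_of_elements
  · intro i z y _ hy
    obtain ⟨u, w, rfl⟩ := (ofCx X).exists_mkEl y
    rw [toCx_d, ofCxHom_f] at hy
    replace hy := (ofCx X).mkEl_inj.1 hy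
    refine ⟨u.1 + w.1, ?_⟩
    rw [map_add, hsum _ z]
    exact congr($(congrArg Subtype.val hy.1) + $(congrArg Subtype.val hy.2))
  · intro i z hz
    obtain ⟨u, w, rfl⟩ := (ofCx X).exists_mkEl z
    rw [toCx_d, zero_eq_mkEl, mkEl_inj] at hz
    have hu : X.d (i + 1) (i + 1 + 1) u.1 = 0 := congrArg Subtype.val hz.1
    have hw : X.d (i + 1) (i + 1 + 1) w.1 = 0 := congrArg Subtype.val hz.2
    refine ⟨u.1 + w.1, 0, by rw [map_add, hu, hw, add_zero], ?_⟩
    rw [map_zero, add_zero, ofCxHom_f]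
    refine (ofCx X).mkEl_inj.2 ⟨Subtype.ext ?_, Subtype.ext ?_⟩
    · refine Eq.symm ((smul_add (A2Alg.gen k (.e 0)) u.1 w.1).trans ?_)
      exact (congrArg₂ _ (ePart.gen_smul u) (ePart.gen_smul_of_ne (by decide) w)).trans
        (add_zero u.1)
    · refine Eq.symm ((smul_add (A2Alg.gen k (.e 1)) u.1 w.1).trans ?_)
      exact (congrArg₂ _ (ePart.gen_smul_of_ne (by decide) u) (ePart.gen_smul w)).trans
        (zero_add w.1)

lemma partCx_exactSucc (X : Cx (A2Alg k)) (e : Fin 2) (i : ℤ)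
    (h : Limits.IsZero (X.homology (i + 1))) : (partCx X e).ExactSucc i := by
  intro z hz
  obtain ⟨w, hw⟩ := Cx.exists_of_isZero_homology i h z.1 (congrArg Subtype.val hz)
  refine ⟨(⟨_, ePart.gen_smul_mem e w⟩ : ePart k e (X.X i)), Subtype.ext ?_⟩
  change X.d i (i + 1) (_ • w) = z.1
  rw [← ePart.gen_smul z, ← hw]
  exact map_smul (X.d i (i + 1)).hom _ w

end RepCx

namespace VecCx
variable (C : VecCx k)

/-- The boundaries in degree `i`. -/
def B (i : ℤ) : Submodule k (C.V i) where
  carrier := {u | ∃ (j : ℤ) (h : j + 1 = i) (w : C.V j), h ▸ C.d j w = u}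
  zero_mem' := by
    obtain ⟨j, rfl⟩ : ∃ j, j + 1 = i := ⟨i - 1, by omega⟩
    exact ⟨j, rfl, 0, map_zero _⟩
  add_mem' := by
    rintro _ _ ⟨j, rfl, w, rfl⟩ ⟨j', h, w', rfl⟩
    obtain rfl : j' = j := by omega
    exact ⟨j', rfl, w + w', map_add ..⟩
  smul_mem' := by
    rintro c _ ⟨j, rfl, w, rfl⟩
    exact ⟨j, rfl, c • w, map_smul ..⟩

lemma mem_B_succ {i : ℤ} {u : C.V (i + 1)} : u ∈ C.B (i + 1) ↔ ∃ w, C.d i w = u := by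
  constructor
  · rintro ⟨j, h, w, rfl⟩
    obtain rfl : j = i := by omega
    exact ⟨w, rfl⟩
  · rintro ⟨w, rfl⟩
    exact ⟨i, rfl, w, rfl⟩

lemma d_mem_B (i : ℤ) (w : C.V i) : C.d i w ∈ C.B (i + 1) := C.mem_B_succ.2 ⟨w, rfl⟩

lemma d_of_mem_B {i : ℤ} {u : C.V i} (h : u ∈ C.B i) : C.d i u = 0 := by
  obtain ⟨j, rfl, w, rfl⟩ := h
  exact C.dd j w

/-- The cocycles in degree `i`. -/
abbrev Z (i : ℤ) : Submodule k (C.V i) := LinearMap.ker (C.d i)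

/-- The cohomology in degree `i`. -/
abbrev H (i : ℤ) : Type := C.Z i ⧸ (C.B i).comap (C.Z i).subtype

/-- The class of a cocycle. -/
abbrev cls (i : ℤ) : C.Z i →ₗ[k] C.H i := Submodule.mkQ _

lemma cls_eq_zero {i : ℤ} {z : C.Z i} : C.cls i z = 0 ↔ z.1 ∈ C.B i :=
  Submodule.Quotient.mk_eq_zero _

lemma cls_eq {i : ℤ} {z z' : C.Z i} : C.cls i z = C.cls i z' ↔ z.1 - z'.1 ∈ C.B i :=
  Submodule.Quotient.eq _

lemma cls_surjective (i : ℤ) : Function.Surjective (C.cls i) := Submodule.mkQ_surjective _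

/-- A linear choice of representatives for cohomology classes. -/
def sec (i : ℤ) : C.H i →ₗ[k] C.Z i :=
  ((C.cls i).exists_rightInverse_of_surjective
    (LinearMap.range_eq_top.2 (C.cls_surjective i))).choose

@[simp] lemma cls_sec (i : ℤ) (h : C.H i) : C.cls i (C.sec i h) = h :=
  congr($(((C.cls i).exists_rightInverse_of_surjective
    (LinearMap.range_eq_top.2 (C.cls_surjective i))).choose_spec) h)

@[simp] lemma d_sec (i : ℤ) (h : C.H i) : C.d i (C.sec i h).1 = 0 := (C.sec i h).2

lemma sub_sec_mem_B {i : ℤ} (z : C.Z i) : z.1 - (C.sec i (C.cls i z)).1 ∈ C.B i :=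
  C.cls_eq.1 (C.cls_sec i _).symm

lemma eq_zero_of_sec_mem_B {i : ℤ} {h : C.H i} (hh : (C.sec i h).1 ∈ C.B i) : h = 0 := by
  rw [← C.cls_sec i h, cls_eq_zero]
  exact hh

/-- A linear choice of preimages of boundaries. -/
def prim (i : ℤ) : C.B (i + 1) →ₗ[k] C.V i :=
  (((C.d i).codRestrict _ (C.d_mem_B i)).exists_rightInverse_of_surjective
    (LinearMap.range_eq_top.2 fun b ↦ by
      obtain ⟨w, hw⟩ := C.mem_B_succ.1 b.2
      exact ⟨w, Subtype.ext hw⟩)).choose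

@[simp] lemma d_prim (i : ℤ) (b : C.B (i + 1)) : C.d i (C.prim i b) = b :=
  congrArg Subtype.val congr($((((C.d i).codRestrict _
    (C.d_mem_B i)).exists_rightInverse_of_surjective
    (LinearMap.range_eq_top.2 fun b ↦ by
      obtain ⟨w, hw⟩ := C.mem_B_succ.1 b.2
      exact ⟨w, Subtype.ext hw⟩)).choose_spec) b)

/-- The difference between a cocycle and the chosen representative of its class. -/
def err (i : ℤ) : C.Z i →ₗ[k] C.B i :=
  ((C.Z i).subtype - (C.Z i).subtype ∘ₗ C.sec i ∘ₗ C.cls i).codRestrict _ C.sub_sec_mem_B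

lemma subsingleton_H {i : ℤ} (h : C.ExactSucc i) : Subsingleton (C.H (i + 1)) := by
  refine subsingleton_of_forall_eq 0 fun v ↦ ?_
  obtain ⟨z, rfl⟩ := C.cls_surjective _ v
  exact C.cls_eq_zero.2 (C.mem_B_succ.2 (h z.1 z.2))

end VecCx

/-- A representation of the quiver with vertices `b i`, `U i` and arrows
`b i → U i`, `b i → U (i + 1)`. -/
structure Zig (k : Type) [Field k] where
  b : ℤ → Type
  U : ℤ → Type
  [grpb : ∀ i, AddCommGroup (b i)]
  [modb : ∀ i, Module k (b i)]
  [grpU : ∀ i, AddCommGroup (U i)]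
  [modU : ∀ i, Module k (U i)]
  x : ∀ i, b i →ₗ[k] U i
  c : ∀ i, b i →ₗ[k] U (i + 1)

attribute [instance] Zig.grpb Zig.modb Zig.grpU Zig.modU

/-- The complex of representations attached to a zigzag. -/
def Zig.toRep (Z : Zig k) : RepCx k where
  U := { V := Z.U, d := fun _ ↦ 0, dd := fun _ _ ↦ rfl }
  W := { V := fun i ↦ Z.b i × Z.U i
         d := fun i ↦ LinearMap.inr k _ _ ∘ₗ Z.c i ∘ₗ LinearMap.fst k _ _
         dd := fun i v ↦ by simp }
  x i := Z.x i ∘ₗ LinearMap.fst k _ _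
  y i := LinearMap.inr k _ _
  xd i w := by simp
  yd i u := by simp
  xy i u := by simp

namespace RepCx
variable (R : RepCx k)

/-- The shifted cone of the map `y`. -/
def cone : VecCx k where
  V i := R.U.V (i + 1) × R.W.V i
  d i := (-(R.U.d (i + 1) ∘ₗ LinearMap.fst k _ _)).prod
    (R.W.d i ∘ₗ LinearMap.snd k _ _ - R.y (i + 1) ∘ₗ LinearMap.fst k _ _)
  dd i v := by simp

lemma cone_d (i : ℤ) (n : R.U.V (i + 1)) (m : R.W.V i) :
    R.cone.d i (n, m) = (-R.U.d (i + 1) n, R.W.d i m - R.y (i + 1) n) := rfl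

lemma cone_cocycle {i : ℤ} {n : R.U.V (i + 1)} {m : R.W.V i} :
    R.cone.d i (n, m) = 0 ↔ R.U.d (i + 1) n = 0 ∧ R.W.d i m = R.y (i + 1) n := by
  rw [cone_d]
  exact Prod.mk_eq_zero.trans (and_congr neg_eq_zero sub_eq_zero)

/-- The first component of a cocycle of the cone. -/
def coneFst (i : ℤ) : R.cone.Z i →ₗ[k] R.U.Z (i + 1) :=
  (LinearMap.fst k _ _ ∘ₗ (R.cone.Z i).subtype).codRestrict _ fun z ↦ (R.cone_cocycle.1 z.2).1

/-- The image under `x` of the second component of a cocycle of the cone. -/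
def coneX (i : ℤ) : R.cone.Z i →ₗ[k] R.U.Z i :=
  (R.x i ∘ₗ LinearMap.snd k _ _ ∘ₗ (R.cone.Z i).subtype).codRestrict _ fun z ↦ by
    have := (R.cone_cocycle.1 z.2).2
    change R.U.d i (R.x i _) = 0
    rw [← R.xd]
    exact (congrArg _ this).trans (R.xy _ _)

/-- The map induced by `coneX` on cohomology. -/
def zigX (i : ℤ) : R.cone.H i →ₗ[k] R.U.H i :=
  Submodule.mapQ _ _ (R.coneX i) (by
    rintro ⟨_, hz⟩ ⟨j, rfl, ⟨n, m⟩, rfl⟩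
    refine R.U.mem_B_succ.2 ⟨R.x j m, ?_⟩
    change _ = R.x (j + 1) (R.W.d j m - R.y (j + 1) n)
    simp)

/-- The map induced by `coneFst` on cohomology. -/
def zigC (i : ℤ) : R.cone.H i →ₗ[k] R.U.H (i + 1) :=
  Submodule.mapQ _ _ (R.coneFst i) (by
    rintro ⟨_, hz⟩ ⟨j, rfl, ⟨n, m⟩, rfl⟩
    exact R.U.mem_B_succ.2 ⟨-n, map_neg ..⟩)

lemma zigX_cls (i : ℤ) (z : R.cone.Z i) :
    R.zigX i (R.cone.cls i z) = R.U.cls i (R.coneX i z) := rfl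

lemma zigC_cls (i : ℤ) (z : R.cone.Z i) :
    R.zigC i (R.cone.cls i z) = R.U.cls (i + 1) (R.coneFst i z) := rfl

/-- The zigzag of cohomology spaces attached to a complex of representations. -/
def zig : Zig k where
  b i := R.cone.H i
  U i := R.U.H i
  x := R.zigX
  c := R.zigC

/-- Exactness of both components kills the zigzag. -/
lemma subsingleton_zig_b {i : ℤ} (hU : R.U.ExactSucc (i + 1)) (hW : R.W.ExactSucc i) :
    Subsingleton (R.zig.b (i + 1)) := by
  refine R.cone.subsingleton_H ?_
  rintro ⟨n, m⟩ hz
  rw [cone_cocycle] at hz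
  obtain ⟨n', rfl⟩ := hU n hz.1
  obtain ⟨m', hm'⟩ := hW (m - R.y _ n') (by simp [hz.2])
  refine ⟨(-n', m'), (R.cone_d i _ _).trans (Prod.ext ?_ ?_)⟩
  · simp
  · simp [hm']

/-- An enlargement of `R` by a contractible complex. -/
def big : RepCx k where
  U := R.U
  W := { V := fun i ↦ R.W.V i × R.U.B (i + 1) × R.U.B i
         d := fun i ↦ (R.W.d i).prodMap (LinearMap.inr k _ _ ∘ₗ LinearMap.fst k _ _)
         dd := fun i v ↦ by simp }
  x i := (R.x i).coprod ((R.U.prim i).coprod (R.U.B i).subtype)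
  y i := LinearMap.inl k _ _ ∘ₗ R.y i
  xd i w := by
    obtain ⟨w, p, q⟩ := w
    simp [R.U.d_of_mem_B q.2]
  yd i u := Prod.ext (R.yd i u) rfl
  xy i u := by simp

lemma big_d (i : ℤ) (w : R.W.V i) (p : R.U.B (i + 1)) (q : R.U.B i) :
    R.big.W.d i (w, p, q) = (R.W.d i w, 0, p) := rfl

/-- The inclusion of `R` in its enlargement. -/
def toBig : Hom R R.big where
  fU _ := LinearMap.id
  fW _ := LinearMap.inl k _ _
  dU _ _ := rfl
  dW _ _ := rfl
  x i w := (by simp : R.x i w = R.x i w + (R.U.prim i 0 + (0 : R.U.B i).1))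
  y _ _ := rfl

instance : QuasiIso R.toBig.toCx := by
  apply Hom.quasiIso_toCx
  · exact fun i z u _ h ↦ ⟨u, h⟩
  · rintro i z ⟨w, p, q⟩ _ h
    exact ⟨w, congrArg Prod.fst h⟩
  · exact fun i z hz ↦ ⟨z, 0, hz, by rw [map_zero, add_zero]; rfl⟩
  · rintro i ⟨w, p, q⟩ hz
    rw [big_d] at hz
    obtain rfl : p = 0 := congrArg (fun z ↦ z.2.2) hz
    refine ⟨w, (0, q, 0), congrArg Prod.fst hz, ?_⟩
    refine Prod.ext ?_ (Prod.ext (add_zero _).symm (zero_add _).symm)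
    change w = w + R.W.d i 0
    rw [map_zero, add_zero]

/-- The first component of the boundary part of the chosen cocycles of the cone. -/
def tau (i : ℤ) : R.cone.H i →ₗ[k] R.U.V i :=
  R.U.prim i ∘ₗ R.U.err (i + 1) ∘ₗ R.coneFst i ∘ₗ R.cone.sec i

lemma d_tau (i : ℤ) (v : R.cone.H i) :
    R.U.d i (R.tau i v) = (R.cone.sec i v).1.1 - (R.U.sec (i + 1) (R.zigC i v)).1 := by
  have h : R.zigC i v = R.U.cls (i + 1) (R.coneFst i (R.cone.sec i v)) := by
    rw [← zigC_cls, VecCx.cls_sec]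
  rw [h]
  exact R.U.d_prim i _

/-- The second component of the chosen cocycles of the cone, corrected so that its
differential comes from the chosen cocycles of `R.U`. -/
def corr (i : ℤ) : R.cone.H i →ₗ[k] R.W.V i :=
  LinearMap.snd k _ _ ∘ₗ (R.cone.Z i).subtype ∘ₗ R.cone.sec i - R.y i ∘ₗ R.tau i

lemma corr_apply (i : ℤ) (v : R.cone.H i) :
    R.corr i v = (R.cone.sec i v).1.2 - R.y i (R.tau i v) := rfl

lemma d_corr (i : ℤ) (v : R.cone.H i) :
    R.W.d i (R.corr i v) = R.y (i + 1) (R.U.sec (i + 1) (R.zigC i v)).1 := by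
  rw [corr_apply, map_sub, ← R.yd, d_tau, map_sub,
    (R.cone_cocycle.1 (R.cone.sec i v).2).2, sub_sub_cancel]

lemma x_corr (i : ℤ) (v : R.cone.H i) :
    (R.U.sec i (R.zigX i v)).1 - R.x i (R.corr i v) ∈ R.U.B i := by
  have h : R.zigX i v = R.U.cls i (R.coneX i (R.cone.sec i v)) := by
    rw [← zigX_cls, VecCx.cls_sec]
  rw [h, corr_apply, map_sub, R.xy, sub_zero, ← neg_mem_iff, neg_sub]
  exact R.U.sub_sec_mem_B (R.coneX i (R.cone.sec i v))

lemma exists_eq_corr_add (i : ℤ) (w : R.W.V (i + 1)) (hw : R.W.d (i + 1) w = 0) :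
    ∃ v h w', R.zigC (i + 1) v = 0 ∧
      w = R.corr (i + 1) v + R.y (i + 1) (R.U.sec (i + 1) h).1 + R.W.d i w' := by
  let z : R.cone.Z (i + 1) := ⟨(0, w), R.cone_cocycle.2 ⟨map_zero _, by rw [hw, map_zero]⟩⟩
  have hc : R.zigC (i + 1) (R.cone.cls _ z) = 0 := by
    rw [zigC_cls]
    exact R.U.cls_eq_zero.2 (zero_mem _)
  obtain ⟨⟨n, m⟩, hnm⟩ := R.cone.mem_B_succ.1 (R.cone.sub_sec_mem_B z)
  have h1 : -R.U.d (i + 1) n = 0 - (R.cone.sec _ (R.cone.cls _ z)).1.1 := congrArg Prod.fst hnm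
  have h2 : R.W.d i m - R.y (i + 1) n = w - (R.cone.sec _ (R.cone.cls _ z)).1.2 :=
    congrArg Prod.snd hnm
  have h3 := R.d_tau _ (R.cone.cls _ z)
  rw [hc, map_zero] at h3
  let n' : R.U.Z (i + 1) := ⟨R.tau _ (R.cone.cls _ z) - n, by
    rw [LinearMap.mem_ker, map_sub, h3, sub_eq_add_neg, h1]
    simp⟩
  obtain ⟨n'', h4⟩ := R.U.mem_B_succ.1 (R.U.sub_sec_mem_B n')
  refine ⟨R.cone.cls _ z, R.U.cls _ n', m + R.y i n'', hc, ?_⟩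
  rw [map_add, ← R.yd, h4, corr_apply, map_sub]
  change w = _ - _ + _ + (_ + (R.y (i + 1) (R.tau _ (R.cone.cls _ z) - n) - _))
  rw [map_sub, sub_eq_iff_eq_add.1 h2.symm]
  abel

lemma eq_zero_of_corr_add (i : ℤ) (v : R.cone.H (i + 1)) (u : R.U.H (i + 1)) (w : R.W.V i)
    (hc : R.zigC (i + 1) v = 0)
    (h : R.corr (i + 1) v + R.y (i + 1) (R.U.sec (i + 1) u).1 = R.W.d i w) :
    v = 0 ∧ ∃ v', R.zigC i v' = u := by
  obtain rfl : v = 0 := by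
    apply R.cone.eq_zero_of_sec_mem_B
    have h3 := R.d_tau _ v
    rw [hc, map_zero] at h3
    refine R.cone.mem_B_succ.2 ⟨((R.U.sec (i + 1) u).1 - R.tau _ v, w),
      (R.cone_d ..).trans (Prod.ext ?_ ?_)⟩
    · simp [h3]
    · change R.W.d i w - R.y (i + 1) _ = _
      rw [← h, corr_apply, map_sub]
      abel
  refine ⟨rfl, R.cone.cls i ⟨((R.U.sec (i + 1) u).1, w), ?_⟩, ?_⟩
  · rw [map_zero, zero_add] at h
    exact R.cone_cocycle.2 ⟨R.U.d_sec _ _, h.symm⟩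
  · exact R.U.cls_sec _ u

/-- The comparison map from the complex built from the zigzag of cohomology spaces. -/
def fromZig : Hom R.zig.toRep R.big where
  fU i := (R.U.Z i).subtype ∘ₗ R.U.sec i
  fW i := (R.corr i ∘ₗ LinearMap.fst k _ _ +
      R.y i ∘ₗ (R.U.Z i).subtype ∘ₗ R.U.sec i ∘ₗ LinearMap.snd k _ _).prod
    (LinearMap.inr k _ _ ∘ₗ LinearMap.codRestrict (R.U.B i)
      ((R.U.Z i).subtype ∘ₗ R.U.sec i ∘ₗ R.zigX i - R.x i ∘ₗ R.corr i) (R.x_corr i) ∘ₗ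
        LinearMap.fst k _ _)
  dU i u := (congrArg (fun u ↦ (R.U.sec (i + 1) u).1) (LinearMap.zero_apply u)).trans
    ((congrArg Subtype.val (map_zero _)).trans (R.U.d_sec i u).symm)
  dW i v := by
    obtain ⟨v, u⟩ : R.cone.H i × R.U.H i := v
    refine Prod.ext ?_ (Prod.ext rfl (Subtype.ext ?_))
    · change R.corr (i + 1) 0 + R.y (i + 1) (R.U.sec (i + 1) (R.zigC i v)).1 =
        R.W.d i (R.corr i v + R.y i (R.U.sec i u).1)
      rw [map_zero, zero_add, map_add, d_corr, ← R.yd, R.U.d_sec, map_zero, add_zero]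
    · change (R.U.sec (i + 1) (R.zigX (i + 1) 0)).1 - R.x (i + 1) (R.corr (i + 1) 0) = 0
      simp
  x i v := by
    obtain ⟨v, u⟩ : R.cone.H i × R.U.H i := v
    change (R.U.sec i (R.zigX i v)).1 = R.x i (R.corr i v + R.y i (R.U.sec i u).1) +
      (R.U.prim i 0 + ((R.U.sec i (R.zigX i v)).1 - R.x i (R.corr i v)))
    simp
  y i u := by
    refine Prod.ext ?_ (Prod.ext rfl (Subtype.ext ?_))
    · change R.corr i 0 + R.y i (R.U.sec i u).1 = R.y i (R.U.sec i u).1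
      rw [map_zero, zero_add]
    · change (R.U.sec i (R.zigX i 0)).1 - R.x i (R.corr i 0) = 0
      simp

instance : QuasiIso R.fromZig.toCx := by
  apply Hom.quasiIso_toCx
  · intro i z u _ h
    exact ⟨0, R.U.eq_zero_of_sec_mem_B (R.U.mem_B_succ.2 ⟨u, h.symm⟩)⟩
  · rintro i ⟨v, u⟩ ⟨w, p, q⟩ hz h
    obtain ⟨rfl, v', rfl⟩ := R.eq_zero_of_corr_add i v u w (congrArg Prod.snd hz)
      (congrArg Prod.fst h)
    exact ⟨(v', 0), rfl⟩
  · intro i z hz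
    obtain ⟨w, hw⟩ := R.U.mem_B_succ.1 (R.U.sub_sec_mem_B ⟨z, hz⟩)
    exact ⟨R.U.cls (i + 1) ⟨z, hz⟩, w, rfl, (add_eq_of_eq_sub' hw).symm⟩
  · rintro i ⟨w, p, q⟩ hz
    rw [big_d] at hz
    obtain rfl : p = 0 := congrArg (fun z ↦ z.2.2) hz
    obtain ⟨v, u, w', hc, hw⟩ := R.exists_eq_corr_add i w (congrArg Prod.fst hz)
    refine ⟨(v, u), (w', q - ⟨_, R.x_corr (i + 1) v⟩, 0), Prod.ext rfl hc, ?_⟩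
    exact Prod.ext hw (Prod.ext (add_zero _).symm (add_sub_cancel _ q).symm)

end RepCx

/-- Every complex of modules is isomorphic in the derived category to the complex built from
its zigzag of cohomology spaces. -/
lemma dbIso_zig (X : Cx (A2Alg k)) : DbIso X (RepCx.ofCx X).zig.toRep.toCx :=
  (DbIso.of_quasiIso (RepCx.ofCxHom X)).trans
    ((DbIso.of_quasiIso (RepCx.ofCx X).toBig.toCx).trans
      (DbIso.of_quasiIso (RepCx.ofCx X).fromZig.toCx).symm)

section LinearAlgebra
variable {V V' : Type} [AddCommGroup V] [Module k V] [AddCommGroup V'] [Module k V']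

lemma exists_dual_eq_one {S : Submodule k V} {v : V} (h : v ∉ S) :
    ∃ l : Module.Dual k V, l v = 1 ∧ ∀ s ∈ S, l s = 0 := by
  obtain ⟨l, hl, hv⟩ := LinearMap.exists_extend_of_notMem (0 : S →ₗ[k] k) h 1
  exact ⟨l, hv, fun s hs ↦ congr($hl ⟨s, hs⟩)⟩

lemma exists_dual_comp_eq (f : V →ₗ[k] V') (S : Submodule k V') (l : Module.Dual k V)
    (hl : ∀ v, f v ∈ S → l v = 0) :
    ∃ m : Module.Dual k V', (∀ v, m (f v) = l v) ∧ ∀ s ∈ S, m s = 0 := by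
  have h : l ∈ LinearMap.range (S.mkQ ∘ₗ f).dualMap := by
    rw [LinearMap.range_dualMap_eq_dualAnnihilator_ker, Submodule.mem_dualAnnihilator]
    exact fun v hv ↦ hl v ((Submodule.Quotient.mk_eq_zero S).1 hv)
  obtain ⟨m, hm⟩ := h
  refine ⟨m ∘ₗ S.mkQ, fun v ↦ congr($hm v), fun s hs ↦ ?_⟩
  rw [LinearMap.comp_apply, Submodule.mkQ_apply, (Submodule.Quotient.mk_eq_zero S).2 hs, map_zero]

end LinearAlgebra

namespace Zig

/-- A morphism of zigzags. -/
structure Hom (Z Z' : Zig k) where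
  fb : ∀ i, Z.b i →ₗ[k] Z'.b i
  fU : ∀ i, Z.U i →ₗ[k] Z'.U i
  x : ∀ i v, fU i (Z.x i v) = Z'.x i (fb i v)
  c : ∀ i v, fU (i + 1) (Z.c i v) = Z'.c i (fb i v)

/-- The morphism of complexes of representations attached to a morphism of zigzags. -/
def Hom.toRep {Z Z' : Zig k} (f : Hom Z Z') : RepCx.Hom Z.toRep Z'.toRep where
  fU := f.fU
  fW i := (f.fb i).prodMap (f.fU i)
  dU i _ := map_zero (f.fU (i + 1))
  dW i v := Prod.ext (map_zero (f.fb (i + 1))) (f.c i v.1)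
  x i v := f.x i v.1
  y i _ := Prod.ext (map_zero (f.fb i)) rfl

/-- A retract of zigzags induces a retract of complexes of modules. -/
def Hom.retract {Z Z' : Zig k} (f : Hom Z Z') (g : Hom Z' Z)
    (hb : ∀ i v, g.fb i (f.fb i v) = v) (hU : ∀ i v, g.fU i (f.fU i v) = v) :
    Retract Z.toRep.toCx Z'.toRep.toCx where
  i := f.toRep.toCx
  r := g.toRep.toCx
  retract := by
    ext i p
    obtain ⟨u, w, rfl⟩ := RepCx.exists_mkEl _ p
    exact (RepCx.mkEl_inj _).2 ⟨hU i u, Prod.ext (hb i w.1) (hU i w.2)⟩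

/-- The subspace of `k` which is everything if `p` holds and zero otherwise. -/
def line (k : Type) [Field k] (p : Prop) : Submodule k k where
  carrier := {a | ¬ p → a = 0}
  zero_mem' _ := rfl
  add_mem' ha hb h := by rw [ha h, hb h, add_zero]
  smul_mem' c a ha h := by rw [ha h, smul_zero]

open Classical in
/-- The projection to `line k p`. -/
def toLine (k : Type) [Field k] (p : Prop) : k →ₗ[k] line k p where
  toFun a := ⟨if p then a else 0, fun h ↦ if_neg h⟩
  map_add' a b := by ext; by_cases h : p <;> simp [h]
  map_smul' a b := by ext; by_cases h : p <;> simp [h]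

lemma coe_toLine {p : Prop} {a : k} (h : ¬ p → a = 0) : (toLine k p a : k) = a := by
  by_cases hp : p
  · exact if_pos hp
  · exact (if_neg hp).trans (h hp).symm

lemma toLine_smul {M : Type} [AddCommGroup M] [Module k M] {p : Prop} (a : k) {m : M}
    (h : ¬ p → m = 0) : (toLine k p a : k) • m = a • m := by
  by_cases hp : p
  · rw [coe_toLine fun h ↦ (h hp).elim]
  · rw [h hp, smul_zero, smul_zero]

lemma toLine_of_not {p : Prop} (h : ¬ p) (a : k) : toLine k p a = 0 := Subtype.ext (if_neg h)

lemma line_eq_zero {p : Prop} (h : ¬ p) (a : line k p) : a = 0 := Subtype.ext (a.2 h)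

/-- The zigzag which is one-dimensional at the given vertices, with identity maps between
adjacent ones. -/
def interval (k : Type) [Field k] (Pb PU : Set ℤ) : Zig k where
  b i := line k (i ∈ Pb)
  U i := line k (i ∈ PU)
  x i := toLine k (i ∈ PU) ∘ₗ (line k (i ∈ Pb)).subtype
  c i := toLine k (i + 1 ∈ PU) ∘ₗ (line k (i ∈ Pb)).subtype

lemma interval_not_quasiIso_zero {Pb PU : Set ℤ} (h : Pb.Nonempty ∨ PU.Nonempty) :
    ¬ QuasiIso (0 : (interval k Pb PU).toRep.toCx ⟶ (interval k Pb PU).toRep.toCx) := by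
  intro hq
  have hU : ∀ i, i ∉ PU := by
    intro i hi
    obtain ⟨i, rfl⟩ : ∃ j, i = j + 1 := ⟨i - 1, by omega⟩
    let u : (interval k Pb PU).U (i + 1) := (⟨1, fun h ↦ (h hi).elim⟩ : line k (i + 1 ∈ PU))
    obtain ⟨p, hp⟩ := Cx.exists_of_quasiIso_zero hq i ((interval k Pb PU).toRep.mkEl u 0)
      ((RepCx.toCx_d ..).trans ((RepCx.mkEl_inj _).2 ⟨rfl, map_zero _⟩))
    obtain ⟨u', w', rfl⟩ := RepCx.exists_mkEl _ p
    have := ((RepCx.mkEl_inj _).1 ((RepCx.toCx_d ..).symm.trans hp)).1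
    exact zero_ne_one (congrArg Subtype.val this)
  obtain ⟨i, hi⟩ : Pb.Nonempty := h.resolve_right fun ⟨i, hi⟩ ↦ hU i hi
  obtain ⟨i, rfl⟩ : ∃ j, i = j + 1 := ⟨i - 1, by omega⟩
  let v : (interval k Pb PU).b (i + 1) := (⟨1, fun h ↦ (h hi).elim⟩ : line k (i + 1 ∈ Pb))
  obtain ⟨p, hp⟩ := Cx.exists_of_quasiIso_zero hq i ((interval k Pb PU).toRep.mkEl 0 (v, 0))
    ((RepCx.toCx_d ..).trans ((RepCx.mkEl_inj _).2 ⟨rfl, Prod.ext rfl (line_eq_zero (hU _) _)⟩))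
  obtain ⟨u', w', rfl⟩ := RepCx.exists_mkEl _ p
  have := ((RepCx.mkEl_inj _).1 ((RepCx.toCx_d ..).symm.trans hp)).2
  exact zero_ne_one (congrArg Subtype.val (congrArg Prod.fst this))

/-- Families of vectors and of functionals spanning a candidate interval summand. -/
structure Thread (Z : Zig k) where
  vb : ∀ i, Z.b i
  vU : ∀ i, Z.U i
  lb : ∀ i, Module.Dual k (Z.b i)
  lU : ∀ i, Module.Dual k (Z.U i)
  hb : ∀ i, vb i = 0 ∧ lb i = 0 ∨ lb i (vb i) = 1
  hU : ∀ i, vU i = 0 ∧ lU i = 0 ∨ lU i (vU i) = 1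

namespace Thread
variable {Z : Zig k} (T : Z.Thread)

/-- The conditions on a thread at the arrow `b i → U i`. -/
def CompatX (i : ℤ) : Prop :=
  (T.vb i ≠ 0 → Z.x i (T.vb i) = T.vU i) ∧ (T.vU i ≠ 0 → ∀ w, T.lU i (Z.x i w) = T.lb i w)

/-- The conditions on a thread at the arrow `b i → U (i + 1)`. -/
def CompatC (i : ℤ) : Prop :=
  (T.vb i ≠ 0 → Z.c i (T.vb i) = T.vU (i + 1)) ∧
    (T.vU (i + 1) ≠ 0 → ∀ w, T.lU (i + 1) (Z.c i w) = T.lb i w)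

/-- The vertices `b i` in the support. -/
def suppb : Set ℤ := {i | T.vb i ≠ 0}

/-- The vertices `U i` in the support. -/
def suppU : Set ℤ := {i | T.vU i ≠ 0}

variable {T}

lemma lb_vb {i : ℤ} (h : T.vb i ≠ 0) : T.lb i (T.vb i) = 1 := (T.hb i).resolve_left fun h' ↦ h h'.1

lemma lU_vU {i : ℤ} (h : T.vU i ≠ 0) : T.lU i (T.vU i) = 1 := (T.hU i).resolve_left fun h' ↦ h h'.1

lemma lb_eq_zero {i : ℤ} (h : T.vb i = 0) : T.lb i = 0 :=
  (T.hb i).elim (·.2) fun h' ↦ by simp [h] at h'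

lemma vb_eq_zero {i : ℤ} (h : i ∉ T.suppb) : T.vb i = 0 := not_not.1 h

lemma vU_eq_zero {i : ℤ} (h : i ∉ T.suppU) : T.vU i = 0 := not_not.1 h

lemma coe_toLine_lb (i : ℤ) (w : Z.b i) : (toLine k (i ∈ T.suppb) (T.lb i w) : k) = T.lb i w :=
  coe_toLine fun h ↦ by rw [lb_eq_zero (vb_eq_zero h), LinearMap.zero_apply]

lemma toLine_lb_smul (i : ℤ) (a : line k (i ∈ T.suppb)) :
    toLine k (i ∈ T.suppb) (T.lb i (a.1 • T.vb i)) = a := by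
  by_cases h : i ∈ T.suppb
  · refine Subtype.ext ?_
    rw [coe_toLine_lb, map_smul, lb_vb h, smul_eq_mul, mul_one]
  · rw [line_eq_zero h a, toLine_of_not h]

lemma toLine_lU_smul (i : ℤ) (a : line k (i ∈ T.suppU)) :
    toLine k (i ∈ T.suppU) (T.lU i (a.1 • T.vU i)) = a := by
  by_cases h : i ∈ T.suppU
  · refine Subtype.ext ?_
    rw [map_smul, lU_vU h, smul_eq_mul, mul_one, coe_toLine fun h' ↦ (h' h).elim]
  · rw [line_eq_zero h a, toLine_of_not h]

variable (T)

/-- The inclusion of the interval attached to a compatible thread. -/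
def incl (hx : ∀ i, T.CompatX i) (hc : ∀ i, T.CompatC i) :
    Hom (interval k T.suppb T.suppU) Z where
  fb i := LinearMap.toSpanSingleton k _ (T.vb i) ∘ₗ (line k (i ∈ T.suppb)).subtype
  fU i := LinearMap.toSpanSingleton k _ (T.vU i) ∘ₗ (line k (i ∈ T.suppU)).subtype
  x i (v : line k (i ∈ T.suppb)) := by
    change (toLine k (i ∈ T.suppU) v.1).1 • T.vU i = Z.x i (v.1 • T.vb i)
    by_cases hv : i ∈ T.suppb
    · rw [map_smul, (hx i).1 hv, toLine_smul _ vU_eq_zero]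
    · simp [line_eq_zero hv v]
  c i (v : line k (i ∈ T.suppb)) := by
    change (toLine k (i + 1 ∈ T.suppU) v.1).1 • T.vU (i + 1) = Z.c i (v.1 • T.vb i)
    by_cases hv : i ∈ T.suppb
    · rw [map_smul, (hc i).1 hv, toLine_smul _ vU_eq_zero]
    · simp [line_eq_zero hv v]

/-- The projection to the interval attached to a compatible thread. -/
def proj (hx : ∀ i, T.CompatX i) (hc : ∀ i, T.CompatC i) :
    Hom Z (interval k T.suppb T.suppU) where
  fb i := toLine k (i ∈ T.suppb) ∘ₗ T.lb i
  fU i := toLine k (i ∈ T.suppU) ∘ₗ T.lU i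
  x i w := by
    change toLine k (i ∈ T.suppU) (T.lU i (Z.x i w)) =
      toLine k (i ∈ T.suppU) (toLine k (i ∈ T.suppb) (T.lb i w)).1
    by_cases hu : i ∈ T.suppU
    · rw [(hx i).2 hu, coe_toLine_lb]
    · rw [toLine_of_not hu, toLine_of_not hu]
  c i w := by
    change toLine k (i + 1 ∈ T.suppU) (T.lU (i + 1) (Z.c i w)) =
      toLine k (i + 1 ∈ T.suppU) (toLine k (i ∈ T.suppb) (T.lb i w)).1
    by_cases hu : i + 1 ∈ T.suppU
    · rw [(hc i).2 hu, coe_toLine_lb]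
    · rw [toLine_of_not hu, toLine_of_not hu]

/-- The retract given by a compatible thread. -/
def retract (hx : ∀ i, T.CompatX i) (hc : ∀ i, T.CompatC i) :
    Retract (interval k T.suppb T.suppU).toRep.toCx Z.toRep.toCx :=
  (T.incl hx hc).retract (T.proj hx hc) toLine_lb_smul toLine_lU_smul

/-- The zero thread. -/
def zero (Z : Zig k) : Z.Thread where
  vb _ := 0
  vU _ := 0
  lb _ := 0
  lU _ := 0
  hb _ := .inl ⟨rfl, rfl⟩
  hU _ := .inl ⟨rfl, rfl⟩

/-- Replace the vector and the functional at `b i`. -/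
def updateb (i : ℤ) (v : Z.b i) (l : Module.Dual k (Z.b i)) (h : l v = 1) : Z.Thread where
  __ := T
  vb := Function.update T.vb i v
  lb := Function.update T.lb i l
  hb j := by
    rcases eq_or_ne j i with rfl | hj
    · simp [h]
    · simpa [hj] using T.hb j

/-- Replace the vector and the functional at `U i`. -/
def updateU (i : ℤ) (v : Z.U i) (l : Module.Dual k (Z.U i)) (h : l v = 1) : Z.Thread where
  __ := T
  vU := Function.update T.vU i v
  lU := Function.update T.lU i l
  hU j := by
    rcases eq_or_ne j i with rfl | hj
    · simp [h]
    · simpa [hj] using T.hU j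

/-- A thread starting at `U i`, separating `S` from `S'`. -/
structure StartsU (i : ℤ) (S S' : Submodule k (Z.U i)) : Prop where
  vb : ∀ j < i, T.vb j = 0
  vU : ∀ j < i, T.vU j = 0
  mem : T.vU i ∈ S'
  one : T.lU i (T.vU i) = 1
  zero : ∀ s ∈ S, T.lU i s = 0
  compatX : ∀ j, T.CompatX j
  compatC : ∀ j, j + 1 ≠ i → T.CompatC j

/-- A thread starting at `b i`, separating `S` from `S'`. -/
structure Startsb (i : ℤ) (S S' : Submodule k (Z.b i)) : Prop where
  vb : ∀ j < i, T.vb j = 0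
  vU : ∀ j ≤ i, T.vU j = 0
  mem : T.vb i ∈ S'
  one : T.lb i (T.vb i) = 1
  zero : ∀ s ∈ S, T.lb i s = 0
  compatX : ∀ j ≠ i, T.CompatX j
  compatC : ∀ j, T.CompatC j

variable {T}

lemma startsU_updateU {i : ℤ} {S S' : Submodule k (Z.U i)} (v : Z.U i) (l : Module.Dual k (Z.U i))
    (h : l v = 1) (hv : v ∈ S') (hl : ∀ s ∈ S, l s = 0) (hvb : ∀ j < i, T.vb j = 0)
    (hvU : ∀ j < i, T.vU j = 0) (hx : ∀ j ≠ i, T.CompatX j) (hc : ∀ j, T.CompatC j)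
    (hxv : T.vb i ≠ 0 → Z.x i (T.vb i) = v) (hxl : ∀ w, l (Z.x i w) = T.lb i w) :
    (T.updateU i v l h).StartsU i S S' where
  vb := hvb
  vU j hj := by simpa [updateU, hj.ne] using hvU j hj
  mem := by simpa [updateU] using hv
  one := by simpa [updateU] using h
  zero := by simpa [updateU] using hl
  compatX j := by
    rcases eq_or_ne j i with rfl | hj
    · simpa [updateU, CompatX] using ⟨hxv, fun _ ↦ hxl⟩
    · simpa [updateU, CompatX, hj] using hx j hj
  compatC j hj := by simpa [updateU, CompatC, hj] using hc j

lemma startsb_updateb {i : ℤ} {S S' : Submodule k (Z.b i)} (v : Z.b i) (l : Module.Dual k (Z.b i))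
    (h : l v = 1) (hv : v ∈ S') (hl : ∀ s ∈ S, l s = 0) (hvb : ∀ j < i, T.vb j = 0)
    (hvU : ∀ j ≤ i, T.vU j = 0) (hx : ∀ j, T.CompatX j) (hc : ∀ j ≠ i, T.CompatC j)
    (hcv : Z.c i v = T.vU (i + 1)) (hcl : T.vU (i + 1) ≠ 0 → ∀ w, T.lU (i + 1) (Z.c i w) = l w) :
    (T.updateb i v l h).Startsb i S S' where
  vb j hj := by simpa [updateb, hj.ne] using hvb j hj
  vU := hvU
  mem := by simpa [updateb] using hv
  one := by simpa [updateb] using h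
  zero := by simpa [updateb] using hl
  compatX j hj := by simpa [updateb, CompatX, hj] using hx j
  compatC j := by
    rcases eq_or_ne j i with rfl | hj
    · simpa [updateb, CompatC] using ⟨fun _ ↦ hcv, hcl⟩
    · simpa [updateb, CompatC, hj] using hc j hj

lemma zero_compatX (i : ℤ) : (zero Z).CompatX i := ⟨fun h ↦ (h rfl).elim, fun h ↦ (h rfl).elim⟩

lemma zero_compatC (i : ℤ) : (zero Z).CompatC i := ⟨fun h ↦ (h rfl).elim, fun h ↦ (h rfl).elim⟩

lemma exists_startsU (i : ℤ)
    (ih : ∀ S S' : Submodule k (Z.b i), S < S' → ∃ T : Z.Thread, T.Startsb i S S')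
    (S S' : Submodule k (Z.U i)) (h : S < S') : ∃ T : Z.Thread, T.StartsU i S S' := by
  by_cases hS : S' ≤ S ⊔ LinearMap.range (Z.x i)
  · obtain ⟨T, hT⟩ := ih (S.comap (Z.x i)) (S'.comap (Z.x i)) (by
      refine lt_of_le_not_ge (Submodule.comap_mono h.le) fun hle ↦ h.not_ge fun s hs ↦ ?_
      obtain ⟨s, hs', _, ⟨t, rfl⟩, rfl⟩ := Submodule.mem_sup.1 (hS hs)
      exact add_mem hs' (hle ((Submodule.add_mem_iff_right _ (h.le hs')).1 hs)))
    obtain ⟨l, hl, hl'⟩ := exists_dual_comp_eq (Z.x i) S (T.lb i) hT.zero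
    exact ⟨_, startsU_updateU (T := T) (Z.x i (T.vb i)) l ((hl _).trans hT.one) hT.mem hl' hT.vb
      (fun j hj ↦ hT.vU j hj.le) hT.compatX hT.compatC (fun _ ↦ rfl) hl⟩
  · obtain ⟨v, hv, hv'⟩ := SetLike.not_le_iff_exists.1 hS
    obtain ⟨l, hl, hl'⟩ := exists_dual_eq_one hv'
    exact ⟨_, startsU_updateU (T := zero Z) v l hl hv
      (fun s hs ↦ hl' s (Submodule.mem_sup_left hs)) (fun _ _ ↦ rfl) (fun _ _ ↦ rfl)
      (fun _ _ ↦ zero_compatX _) zero_compatC (fun h ↦ (h rfl).elim)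
      (fun w ↦ hl' _ (Submodule.mem_sup_right ⟨w, rfl⟩))⟩

lemma exists_startsb (i : ℤ)
    (ih : ∀ S S' : Submodule k (Z.U (i + 1)), S < S' → ∃ T : Z.Thread, T.StartsU (i + 1) S S')
    (S S' : Submodule k (Z.b i)) (h : S < S') : ∃ T : Z.Thread, T.Startsb i S S' := by
  by_cases hS : S' ⊓ LinearMap.ker (Z.c i) ≤ S
  · obtain ⟨T, hT⟩ := ih (S.map (Z.c i)) (S'.map (Z.c i)) (by
      refine lt_of_le_not_ge (Submodule.map_mono h.le) fun hle ↦ h.not_ge fun s hs ↦ ?_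
      obtain ⟨t, ht, hst⟩ := hle (Submodule.mem_map_of_mem hs)
      have := hS ⟨sub_mem hs (h.le ht), by simp [hst]⟩
      simpa using add_mem this ht)
    obtain ⟨v, hv, hv'⟩ := hT.mem
    exact ⟨_, startsb_updateb (T := T) v (T.lU (i + 1) ∘ₗ Z.c i)
      ((congrArg _ hv').trans hT.one) hv (fun s hs ↦ hT.zero _ (Submodule.mem_map_of_mem hs))
      (fun j hj ↦ hT.vb j (by omega)) (fun j hj ↦ hT.vU j (by omega)) hT.compatX
      (fun j hj ↦ hT.compatC j (by omega)) hv' (fun _ _ ↦ rfl)⟩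
  · obtain ⟨v, hv, hv'⟩ := SetLike.not_le_iff_exists.1 hS
    obtain ⟨l, hl, hl'⟩ := exists_dual_eq_one hv'
    exact ⟨_, startsb_updateb (T := zero Z) v l hl hv.1 hl' (fun _ _ ↦ rfl) (fun _ _ ↦ rfl)
      zero_compatX (fun _ _ ↦ zero_compatC _) hv.2 (fun h ↦ (h rfl).elim)⟩

/-- A nonzero zigzag supported in finitely many degrees has a compatible nonzero thread. -/
lemma exists_compat (p q : ℤ) (hb : ∀ i, i < p ∨ q < i → Subsingleton (Z.b i))
    (hU : ∀ i, i < p ∨ q < i → Subsingleton (Z.U i))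
    (hZ : ¬ ∀ i, Subsingleton (Z.b i) ∧ Subsingleton (Z.U i)) :
    ∃ T : Z.Thread, (∀ i, T.CompatX i) ∧ (∀ i, T.CompatC i) ∧
      (T.suppb.Nonempty ∨ T.suppU.Nonempty) := by
  have key : ∀ (n : ℕ) (i : ℤ), q < i + n →
      (∀ S S' : Submodule k (Z.U i), S < S' → ∃ T : Z.Thread, T.StartsU i S S') ∧
      (∀ S S' : Submodule k (Z.b i), S < S' → ∃ T : Z.Thread, T.Startsb i S S') := by
    intro n
    induction n with
    | zero =>
      intro i hi
      have := hb i (by omega)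
      have := hU i (by omega)
      exact ⟨fun S S' h ↦ (h.ne (Subsingleton.elim _ _)).elim,
        fun S S' h ↦ (h.ne (Subsingleton.elim _ _)).elim⟩
    | succ n ih =>
      intro i hi
      have h := exists_startsb i (ih (i + 1) (by omega)).1
      exact ⟨exists_startsU i h, h⟩
  obtain ⟨i, hi, hmin⟩ := Int.exists_least_of_bdd
    (P := fun i ↦ ¬ (Subsingleton (Z.b i) ∧ Subsingleton (Z.U i)))
    ⟨p, fun i hi ↦ not_lt.1 fun h ↦ hi ⟨hb i (.inl h), hU i (.inl h)⟩⟩ (not_forall.1 hZ)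
  have hkey := key (q - i + 1).toNat i (by omega)
  by_cases hUi : Subsingleton (Z.U i)
  · have : Nontrivial (Z.b i) := not_subsingleton_iff_nontrivial.1 fun h ↦ hi ⟨h, hUi⟩
    obtain ⟨T, hT⟩ := hkey.2 ⊥ ⊤ bot_lt_top
    refine ⟨T, fun j ↦ ?_, hT.compatC, .inl ⟨i, fun h ↦ ?_⟩⟩
    · rcases eq_or_ne j i with rfl | hj
      · exact ⟨fun _ ↦ Subsingleton.elim _ _, fun h ↦ (h (Subsingleton.elim _ _)).elim⟩
      · exact hT.compatX j hj
    · simpa [h] using hT.one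
  · have : Nontrivial (Z.U i) := not_subsingleton_iff_nontrivial.1 hUi
    obtain ⟨T, hT⟩ := hkey.1 ⊥ ⊤ bot_lt_top
    refine ⟨T, hT.compatX, fun j ↦ ?_, .inr ⟨i, fun h ↦ ?_⟩⟩
    · by_cases hj : j + 1 = i
      · have : Subsingleton (Z.b j) := by
          by_contra h
          have := hmin j fun h' ↦ h h'.1
          omega
        refine ⟨fun h ↦ (h (Subsingleton.elim _ _)).elim, fun _ w ↦ ?_⟩
        rw [Subsingleton.elim w 0, map_zero, map_zero, map_zero]
      · exact hT.compatC j hj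
    · simpa [h] using hT.one

end Thread

end Zig

lemma CohDims.isZero_homology {A : Type} [Ring A] [Algebra k A] {X : Cx A} {d : ℤ → ℕ}
    (h : CohDims k X d) {i : ℤ} (hi : d i = 0) : Limits.IsZero (X.homology i) := by
  let : Module k (X.homology i) := Module.compHom _ (algebraMap k A)
  have : Module.Finite k (X.homology i) := (h i).1
  have : Subsingleton (X.homology i) := Module.finrank_zero_iff.1 ((h i).2.trans hi)
  exact ModuleCat.isZero_of_subsingleton _

lemma CohDims.eq_zero {A : Type} [Ring A] [Algebra k A] {X : Cx A} {d : ℤ → ℕ}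
    (h : CohDims k X d) {i : ℤ} (hi : Limits.IsZero (X.X i)) : d i = 0 := by
  have hz : Limits.IsZero (X.homology i) :=
    ShortComplex.isZero_homology_of_isZero_X₂ (X.sc i) hi
  have : Subsingleton (X.homology i) := ModuleCat.subsingleton_of_isZero hz
  have : Subsingleton (RestrictScalars k A (X.homology i)) := this
  rw [← (h i).2]
  exact Module.finrank_zero_of_subsingleton

/-- An indecomposable with cohomology concentrated in degrees `p, …, q` is isomorphic to
the complex attached to an interval. -/
lemma DbIndec.exists_interval {X : Cx (A2Alg k)} (hX : DbIndec X) (p q : ℤ)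
    (h : ∀ i, i < p ∨ q < i → Limits.IsZero (X.homology i)) :
    ∃ Pb PU : Set ℤ, Pb ⊆ Set.Icc (p - 1) q ∧ PU ⊆ Set.Icc (p - 1) q ∧
      DbIso X (Zig.interval k Pb PU).toRep.toCx := by
  set Z := (RepCx.ofCx X).zig
  have hb : ∀ i, i < p - 1 ∨ q < i → Subsingleton (Z.b i) := fun i hi ↦ by
    obtain ⟨i, rfl⟩ : ∃ j, i = j + 1 := ⟨i - 1, by omega⟩
    exact (RepCx.ofCx X).subsingleton_zig_b
      (RepCx.partCx_exactSucc X 0 (i + 1) (h _ (by omega)))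
      (RepCx.partCx_exactSucc X 1 i (h _ (by omega)))
  have hU : ∀ i, i < p - 1 ∨ q < i → Subsingleton (Z.U i) := fun i hi ↦ by
    obtain ⟨i, rfl⟩ : ∃ j, i = j + 1 := ⟨i - 1, by omega⟩
    exact (RepCx.ofCx X).U.subsingleton_H (RepCx.partCx_exactSucc X 0 i (h _ (by omega)))
  obtain ⟨T, hx, hc, hT⟩ := Zig.Thread.exists_compat (p - 1) q hb hU fun hZ ↦
    hX.not_isZero (dbIso_zig X) fun i ↦ ⟨fun a b ↦ by
      have := (hZ i).1
      have := (hZ i).2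
      obtain ⟨u, v, rfl⟩ := RepCx.exists_mkEl _ a
      obtain ⟨u', v', rfl⟩ := RepCx.exists_mkEl _ b
      exact (RepCx.mkEl_inj _).2 ⟨Subsingleton.elim (α := Z.U i) _ _,
        Subsingleton.elim (α := Z.b i × Z.U i) _ _⟩⟩
  refine ⟨T.suppb, T.suppU, fun i hi ↦ ?_, fun i hi ↦ ?_, hX.dbIso_of_retract (dbIso_zig X)
    (T.retract hx hc) (Zig.interval_not_quasiIso_zero hT)⟩ <;> by_contra hn <;>
    rw [Set.mem_Icc, not_and_or, not_le, not_le] at hn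
  · exact hi ((hb i hn).elim _ _)
  · exact hi ((hU i hn).elim _ _)
end Modules

/-- **The algebra `A_2` is derived discrete**: for every cohomology dimension vector there
are, up to isomorphism, only finitely many indecomposables in `D^b(A_2)` with that cohomology
dimension vector. -/
theorem A2_derivedDiscrete (k : Type) [Field k] [IsAlgClosed k] :
    DerivedDiscrete k (A2Alg k) := by
  intro d
  by_cases h : ∃ X : Cx (A2Alg k), CxBounded X ∧ CohDims k X d
  · obtain ⟨X₀, ⟨p, q, hpq⟩, hX₀⟩ := h
    have hd : ∀ i, i < p ∨ q < i → d i = 0 := fun i hi ↦ hX₀.eq_zero (hpq i hi)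
    have hfin : (Set.Icc (p - 1) q).powerset.Finite := (Set.finite_Icc _ _).finite_subsets
    have : Finite ((Set.Icc (p - 1) q).powerset ×ˢ (Set.Icc (p - 1) q).powerset : Set _) :=
      (hfin.prod hfin).to_subtype
    obtain ⟨n, ⟨e⟩⟩ := Finite.exists_equiv_fin
      ((Set.Icc (p - 1) q).powerset ×ˢ (Set.Icc (p - 1) q).powerset : Set (Set ℤ × Set ℤ))
    refine ⟨n, fun j ↦ (Zig.interval k (e.symm j).1.1 (e.symm j).1.2).toRep.toCx,
      fun X _ hX hX' ↦ ?_⟩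
    obtain ⟨Pb, PU, hb, hU, hiso⟩ := hX'.exists_interval p q
      fun i hi ↦ hX.isZero_homology (hd i hi)
    obtain ⟨j, hj⟩ : ∃ j, (e.symm j).1 = (Pb, PU) :=
      ⟨e ⟨(Pb, PU), hb, hU⟩, by rw [e.symm_apply_apply]⟩
    refine ⟨j, ?_⟩
    change DbIso X (Zig.interval k (e.symm j).1.1 (e.symm j).1.2).toRep.toCx
    rwa [hj]
  · exact ⟨0, Fin.elim0, fun X hb hX _ ↦ (h ⟨X, hb, hX⟩).elim⟩

end
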